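/- Fix m ∈ ℕ₀ and let f be a bounded, Riemann integrable function on [−1,1]. Then lim_{n→∞} (1/N_n^m) Σ_{k=−n}^n Σ_{i=1}^{N_k} f(x_{|k|,i}) = (1/2) ∫_{−1}^1 f(x) dx, where for each n ≥ m the numbers x_{|k|,i}, N_k and N_n^m are as defined below. -/

import Mathlib

open MeasureTheory Finset

noncomputable section

namespace SFT

/-- The recurrence coefficients `b_l^{(α)}` of the orthonormal ultraspherical polynomials. -/
def b (α : ℝ) : ℕ → ℝ
  | 0 => Real.sqrt (Real.sqrt Real.pi * Real.Gamma (α + 1) / (2 * Real.Gamma (α + 3 / 2)))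
  | l + 1 => Real.sqrt ((((l : ℝ) + 1) * (((l : ℝ) + 1) + 2 * α)) /
      ((2 * ((l : ℝ) + 1) + 2 * α + 1) * (2 * ((l : ℝ) + 1) + 2 * α - 1)))

/-- The associated ultraspherical polynomials: `pA α m l x = p_l^{(α)}(x, m)`.
For `m = 0` these are the orthonormal ultraspherical polynomials `p_l^{(α)}(x)`. -/
def pA (α : ℝ) (m : ℕ) : ℕ → ℝ → ℝ
  | 0, _ => 1 / b α m
  | 1, x => x * (1 / b α m) / b α (m + 1)
  | l + 2, x => (x * pA α m (l + 1) x - b α (m + l + 1) * pA α m l x) / b α (m + l + 2)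

/-- The orthonormal ultraspherical polynomials `p_l^{(α)}(x)`. -/
def p (α : ℝ) (l : ℕ) (x : ℝ) : ℝ := pA α 0 l x

/-- Ultraspherical polynomials with integer index; in particular `p_{-1}^{(α)} = 0`. -/
def pZ (α : ℝ) (l : ℤ) (x : ℝ) : ℝ := if 0 ≤ l then p α l.toNat x else 0

/-- `JE α M i j` is the `(i,j)` entry (`0`-based) of the truncated Jacobi matrix
`J(α)_L^M` (of any size `L − M + 1`). -/
def JE (α : ℝ) (M : ℕ) (i j : ℕ) : ℝ :=
  if i + 1 = j then b α (M + i + 1) else if j + 1 = i then b α (M + j + 1) else 0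

/-- The truncated Jacobi matrix `J(α)_{M+l}^M`, of size `(l+1) × (l+1)`.
In particular `Jt α 0 l` is the Jacobi matrix `J(α)_l`. -/
def Jt (α : ℝ) (M l : ℕ) : Matrix (Fin (l + 1)) (Fin (l + 1)) ℝ :=
  fun i j => JE α M i.1 j.1

/-- The spherical harmonics `Y_l^k(θ, φ)`. -/
def Y (l : ℕ) (k : ℤ) (θ φ : ℝ) : ℂ :=
  ((Real.sin θ ^ k.natAbs : ℝ) : ℂ) * ((p (k.natAbs : ℝ) (l - k.natAbs) (Real.cos θ) : ℝ) : ℂ) *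
    Complex.exp (Complex.I * (k : ℂ) * (φ : ℂ))

/-- Parameter region `[0, π] × [0, 2π]` of spherical coordinates. -/
def region : Set (ℝ × ℝ) := Set.Icc (0 : ℝ) Real.pi ×ˢ Set.Icc (0 : ℝ) (2 * Real.pi)

/-- The inner product of `L²(S²)`. -/
def inner2 (f g : ℝ → ℝ → ℂ) : ℂ :=
  (1 / (4 * Real.pi)) *
    ∫ q in region, f q.1 q.2 * (starRingEnd ℂ) (g q.1 q.2) * ((Real.sin q.1 : ℝ) : ℂ)

/-- The norm of `L²(S²)`. -/
def norm2 (f : ℝ → ℝ → ℂ) : ℝ := Real.sqrt (inner2 f f).re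

/-- Membership in `L²(S²)`. -/
def MemL2 (f : ℝ → ℝ → ℂ) : Prop :=
  Measurable (fun q : ℝ × ℝ => f q.1 q.2) ∧
    IntegrableOn (fun q : ℝ × ℝ => ‖f q.1 q.2‖ ^ 2 * Real.sin q.1) region

/-- The multiplication operator `M`. -/
def Mop (f : ℝ → ℝ → ℂ) : ℝ → ℝ → ℂ := fun θ φ => ((Real.cos θ : ℝ) : ℂ) * f θ φ

/-- The power `M^j` of the multiplication operator. -/
def Mpow (j : ℕ) (f : ℝ → ℝ → ℂ) : ℝ → ℝ → ℂ := fun θ φ => ((Real.cos θ : ℝ) : ℂ) ^ j * f θ φ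

/-- The mean value `ε(f)`. -/
def eps (f : ℝ → ℝ → ℂ) : ℝ :=
  (1 / (4 * Real.pi)) * ∫ q in region, Real.cos q.1 * ‖f q.1 q.2‖ ^ 2 * Real.sin q.1

/-- The projection `P_n^m` onto `Π_n^m`. -/
def Pr (n m : ℕ) (f : ℝ → ℝ → ℂ) : ℝ → ℝ → ℂ :=
  fun θ φ => ∑ l ∈ Finset.Icc m n, ∑ k ∈ Finset.Icc (-(l : ℤ)) (l : ℤ),
    inner2 f (Y l k) * Y l k θ φ

/-- The space–frequency operator `P_n^m M P_n^m`. -/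
def SFop (n m : ℕ) (f : ℝ → ℝ → ℂ) : ℝ → ℝ → ℂ := Pr n m (Mop (Pr n m f))

/-- The space `Π_n^m`, spanned by the spherical harmonics `Y_l^k`, `m ≤ l ≤ n`, `|k| ≤ l`. -/
def Pi_nm (n m : ℕ) : Submodule ℂ (ℝ → ℝ → ℂ) :=
  Submodule.span ℂ {g | ∃ l : ℕ, ∃ k : ℤ, m ≤ l ∧ l ≤ n ∧ k.natAbs ≤ l ∧ g = Y l k}

/-- `N_k = n − max(|k|, m) + 1`. -/
def Nk (n m k : ℕ) : ℕ := n - max k m + 1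

/-- The normalizing constant `κ_{k,i}`, given the corresponding root value `xr`. -/
def kap (n m k : ℕ) (xr : ℝ) : ℝ :=
  (Real.sqrt (∑ l ∈ Finset.Icc (max k m) n, (pA (k : ℝ) (m - k) (l - max k m) xr) ^ 2))⁻¹

/-- The eigenfunction `ψ_{k,i}`, given the corresponding root value `xr`. -/
def psiFun (n m : ℕ) (k : ℤ) (xr : ℝ) : ℝ → ℝ → ℂ :=
  fun θ φ => ((kap n m k.natAbs xr : ℝ) : ℂ) *
    ∑ l ∈ Finset.Icc (max k.natAbs m) n,
      ((pA (k.natAbs : ℝ) (m - k.natAbs) (l - max k.natAbs m) xr : ℝ) : ℂ) * Y l k θ φ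

/-! ### Positivity of the coefficients -/

lemma b_pos (k l : ℕ) : 0 < b (k : ℝ) l := by
  cases l with
  | zero =>
    have h1 : 0 < Real.Gamma ((k : ℝ) + 1) := Real.Gamma_pos_of_pos (by positivity)
    have h2 : 0 < Real.Gamma ((k : ℝ) + 3 / 2) := Real.Gamma_pos_of_pos (by positivity)
    have h3 := Real.pi_pos
    unfold b
    positivity
  | succ l =>
    unfold b
    apply Real.sqrt_pos.2
    have h0 : (0 : ℝ) ≤ l := by positivity
    have h1 : (0 : ℝ) ≤ k := by positivity
    apply div_pos
    · positivity
    · apply mul_pos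
      · positivity
      · linarith

lemma b_succ_sq (k l : ℕ) : b (k : ℝ) (l + 1) ^ 2 =
    ((((l : ℝ) + 1) * (((l : ℝ) + 1) + 2 * k)) /
      ((2 * ((l : ℝ) + 1) + 2 * k + 1) * (2 * ((l : ℝ) + 1) + 2 * k - 1))) := by
  unfold b
  apply Real.sq_sqrt
  have h0 : (0 : ℝ) ≤ l := by positivity
  have h1 : (0 : ℝ) ≤ k := by positivity
  apply div_nonneg
  · positivity
  · apply mul_nonneg
    · positivity
    · linarith

lemma pA_rec (k M l : ℕ) (x : ℝ) :
    b (k : ℝ) (M + l + 2) * pA (k : ℝ) M (l + 2) x =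
      x * pA (k : ℝ) M (l + 1) x - b (k : ℝ) (M + l + 1) * pA (k : ℝ) M l x := by
  have := (b_pos k (M + l + 2)).ne'
  rw [pA]
  field_simp

lemma pA_rec0 (k M : ℕ) (x : ℝ) :
    b (k : ℝ) (M + 1) * pA (k : ℝ) M 1 x = x * pA (k : ℝ) M 0 x := by
  have := (b_pos k (M + 1)).ne'
  rw [pA, pA]
  field_simp

lemma pA_neg (k M : ℕ) (x : ℝ) (l : ℕ) :
    pA (k : ℝ) M l (-x) = (-1) ^ l * pA (k : ℝ) M l x := by
  induction l using Nat.strong_induction_on with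
  | _ l ih =>
    match l with
    | 0 => simp [pA]
    | 1 => simp [pA]; ring
    | l + 2 =>
      rw [pA, ih l (by omega), ih (l + 1) (by omega), pA]
      ring

/-- the chain-sequence weight `1 - g`. -/
lemma pA_pos (k M : ℕ) (x : ℝ) (hx : 1 ≤ x) (l : ℕ) :
    0 < pA (k : ℝ) M l x ∧
    ((M + l : ℕ) + 2 * (k : ℝ) + 1) / (2 * ((M + l : ℕ) + (k : ℝ)) + 1) * pA (k : ℝ) M l x ≤
      b (k : ℝ) (M + l + 1) * pA (k : ℝ) M (l + 1) x := by
  induction l with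
  | zero =>
    have h0 : 0 < pA (k : ℝ) M 0 x := by
      rw [pA]; have := b_pos k M; positivity
    refine ⟨h0, ?_⟩
    have e := pA_rec0 k M x
    simp only [Nat.add_zero, zero_add] at *
    rw [e]
    apply mul_le_mul_of_nonneg_right _ h0.le
    apply le_trans _ hx
    rw [div_le_one (by positivity)]
    have : (0 : ℝ) ≤ M := by positivity
    linarith
  | succ l ih =>
    obtain ⟨h0, h1⟩ := ih
    have hb := b_pos k (M + l + 1)
    have h2 : 0 < pA (k : ℝ) M (l + 1) x := by
      by_contra hc
      push Not at hc
      have : b (k : ℝ) (M + l + 1) * pA (k : ℝ) M (l + 1) x ≤ 0 :=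
        mul_nonpos_of_nonneg_of_nonpos hb.le hc
      have : 0 < ((M + l : ℕ) + 2 * (k : ℝ) + 1) / (2 * ((M + l : ℕ) + (k : ℝ)) + 1)
        * pA (k : ℝ) M l x := by positivity
      linarith
    refine ⟨h2, ?_⟩
    have e := pA_rec k M l x
    have e2 : M + (l + 1) + 1 = M + l + 2 := by ring
    have e3 : l + 1 + 1 = l + 2 := rfl
    rw [e2, e3, e]
    have hs := b_succ_sq k (M + l)
    set y : ℝ := ((M + l : ℕ) : ℝ) with hy
    have hy0 : 0 ≤ y := by positivity
    have hk0 : (0 : ℝ) ≤ k := by positivity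
    have e4 : ((M + (l + 1) : ℕ) : ℝ) = y + 1 := by rw [hy]; push_cast; ring
    rw [e4]
    set B := b (k : ℝ) (M + l + 1)
    set P1 := pA (k : ℝ) M (l + 1) x
    set P0 := pA (k : ℝ) M l x
    have h3 : P0 ≤ (2 * (y + k) + 1) / (y + 2 * k + 1) * (B * P1) := by
      calc P0 = (2 * (y + k) + 1) / (y + 2 * k + 1) * ((y + 2 * k + 1) / (2 * (y + k) + 1) * P0) := by
            field_simp
        _ ≤ _ := by gcongr
    have h4 : B * P0 ≤ (y + 1) / (2 * (y + 1 + k) + 1) * P1 := by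
      calc B * P0 ≤ B * ((2 * (y + k) + 1) / (y + 2 * k + 1) * (B * P1)) := by gcongr
        _ = (2 * (y + k) + 1) / (y + 2 * k + 1) * B ^ 2 * P1 := by ring
        _ = _ := by
          rw [hs]
          congr 1
          have : 2 * (y + 1) + 2 * (k : ℝ) - 1 = 2 * (y + k) + 1 := by ring
          rw [this]
          field_simp
          ring
    have h5 : 1 * P1 ≤ x * P1 := by gcongr
    have h6 : (y + 1 + 2 * (k : ℝ) + 1) / (2 * (y + 1 + k) + 1) * P1 =
      P1 - (y + 1) / (2 * (y + 1 + k) + 1) * P1 := by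
      field_simp
      ring
    linarith

lemma root_mem (k M l : ℕ) (x : ℝ) (h : pA (k : ℝ) M l x = 0) : x ∈ Set.Icc (-1 : ℝ) 1 := by
  constructor
  · by_contra hc
    push Not at hc
    have := (pA_pos k M (-x) (by linarith) l).1
    rw [pA_neg, h] at this
    simp at this
  · by_contra hc
    push Not at hc
    have := (pA_pos k M x (by linarith) l).1
    linarith

/-! ### Walks -/

/-- weighted walks on `ℤ`. -/
def U (a : ℤ → ℝ) (c : ℤ) : ℕ → ℤ → ℝ
  | 0, s => if s = c then 1 else 0
  | j + 1, s => a s * U a c j (s + 1) + a (s - 1) * U a c j (s - 1)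

/-- unweighted walk count -/
def W (j : ℕ) (s : ℤ) : ℝ := U (fun _ => 1) 0 j s

lemma W_succ (j : ℕ) (s : ℤ) : W (j + 1) s = W j (s + 1) + W j (s - 1) := by
  simp [W, U]

lemma U_supp (a : ℤ → ℝ) (c : ℤ) (j : ℕ) (s : ℤ) (h : (j : ℤ) < |s - c|) : U a c j s = 0 := by
  induction j generalizing s with
  | zero =>
    rw [U, if_neg]
    rintro rfl
    simp at h
  | succ j ih =>
    rw [U, ih, ih]
    · ring
    · push_cast at h
      rw [lt_abs] at *
      omega
    · push_cast at h
      rw [lt_abs] at *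
      omega

lemma U_bound (a : ℤ → ℝ) (ha : ∀ s, |a s| ≤ 1) (c : ℤ) (j : ℕ) (s : ℤ) : |U a c j s| ≤ 2 ^ j := by
  induction j generalizing s with
  | zero =>
    rw [U]; split_ifs <;> simp
  | succ j ih =>
    rw [U]
    calc _ ≤ |a s * U a c j (s + 1)| + |a (s - 1) * U a c j (s - 1)| := abs_add_le _ _
      _ = |a s| * |U a c j (s + 1)| + |a (s - 1)| * |U a c j (s - 1)| := by rw [abs_mul, abs_mul]
      _ ≤ 1 * 2 ^ j + 1 * 2 ^ j := by
        gcongr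
        · exact ha _
        · exact ih _
        · exact ha _
        · exact ih _
      _ = _ := by ring

lemma W_bound (j : ℕ) (s : ℤ) : |W j s| ≤ 2 ^ j := U_bound _ (by simp) _ _ _

lemma U_approx (a : ℤ → ℝ) (ha : ∀ s, |a s| ≤ 1) (c : ℤ) (β δ : ℝ) (hβ0 : 0 ≤ β) (hβ : β ≤ 1)
    (hδ : 0 ≤ δ)
    (r : ℕ) (hw : ∀ s : ℤ, |s - c| ≤ r + 1 → |a s - β| ≤ δ) (j : ℕ) (hj : j ≤ r) (s : ℤ) :
    |U a c j s - β ^ j * W j (s - c)| ≤ j * 2 ^ j * δ := by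
  induction j generalizing s with
  | zero =>
    simp [W, U, sub_eq_zero]
  | succ j ih =>
    have key : ∀ s' t : ℤ, |s' - t| ≤ 1 →
        |a s' * U a c j t - β * (β ^ j * W j (t - c))| ≤ 2 ^ j * δ + j * 2 ^ j * δ := by
      intro s' t hst
      by_cases ht : (j : ℤ) < |t - c|
      · rw [U_supp a c j t ht, W, U_supp _ 0 j (t - c) (by simpa using ht)]
        simp only [mul_zero, sub_zero, abs_zero]
        positivity
      · have h1 : |a s' - β| ≤ δ := by
          apply hw
          push Not at ht
          rw [abs_le] at *
          omega
        have h2 := ih (by omega) t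
        calc _ = |(a s' - β) * U a c j t + β * (U a c j t - β ^ j * W j (t - c))| := by
              congr 1; ring
          _ ≤ |(a s' - β) * U a c j t| + |β * (U a c j t - β ^ j * W j (t - c))| := abs_add_le _ _
          _ = |a s' - β| * |U a c j t| + β * |U a c j t - β ^ j * W j (t - c)| := by
            rw [abs_mul, abs_mul, abs_of_nonneg hβ0]
          _ ≤ δ * 2 ^ j + 1 * (j * 2 ^ j * δ) := by
            gcongr
            exact U_bound a ha c j t
          _ = _ := by ring
    have k1 := key s (s + 1) (by simp)
    have k2 := key (s - 1) (s - 1) (by simp)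
    rw [U, W_succ]
    have e1 : s - c + 1 = s + 1 - c := by ring
    have e2 : s - c - 1 = s - 1 - c := by ring
    rw [e1, e2]
    calc _ = |(a s * U a c j (s + 1) - β * (β ^ j * W j (s + 1 - c))) +
          (a (s - 1) * U a c j (s - 1) - β * (β ^ j * W j (s - 1 - c)))| := by congr 1; ring
      _ ≤ _ := abs_add_le _ _
      _ ≤ (2 ^ j * δ + j * 2 ^ j * δ) + (2 ^ j * δ + j * 2 ^ j * δ) := add_le_add k1 k2
      _ = _ := by push_cast; ring

lemma W_choose (j q : ℕ) : W j (2 * q - j) = (j.choose q : ℝ) := by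
  induction j generalizing q with
  | zero =>
    cases q with
    | zero => simp [W, U]
    | succ q =>
      simp [W, U]
      omega
  | succ j ih =>
    rw [W_succ]
    have e1 : 2 * (q : ℤ) - ((j + 1 : ℕ) : ℤ) + 1 = 2 * q - j := by push_cast; ring
    rw [e1, ih]
    cases q with
    | zero =>
      rw [W, U_supp]
      · simp
      · push_cast
        rw [lt_abs]; omega
    | succ q =>
      have e2 : 2 * ((q + 1 : ℕ) : ℤ) - ((j + 1 : ℕ) : ℤ) - 1 = 2 * q - j := by push_cast; ring
      rw [e2, ih, Nat.choose_succ_succ]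
      push_cast; ring

lemma W_odd (j : ℕ) (s : ℤ) (h : Odd ((j : ℤ) + s)) : W j s = 0 := by
  induction j generalizing s with
  | zero =>
    simp only [W, U]
    rw [if_neg]
    rintro rfl
    simp at h
  | succ j ih =>
    rw [W_succ, ih, ih]
    · ring
    · push_cast at h; rw [Int.odd_iff] at *; omega
    · push_cast at h; rw [Int.odd_iff] at *; omega

lemma W_even_zero (r : ℕ) : W (2 * r) 0 = (Nat.centralBinom r : ℝ) := by
  have := W_choose (2 * r) r
  rw [Nat.centralBinom, ← this]
  congr 1
  push_cast; ring

lemma W_odd_zero (r : ℕ) : W (2 * r + 1) 0 = 0 := by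
  apply W_odd
  push_cast
  rw [Int.odd_iff]; omega

/-! ### Trace of powers -/

/-- edge weights on `ℤ`. -/
def aw (k M N : ℕ) (s : ℤ) : ℝ :=
  if 0 ≤ s ∧ s + 1 < N then b (k : ℝ) (M + s.toNat + 1) else 0

lemma JE_sum (k M N : ℕ) (w : ℤ → ℝ) (i : Fin N) :
    ∑ l : Fin N, JE (k : ℝ) M i.1 l.1 * w l.1 =
      aw k M N i.1 * w (i.1 + 1) + aw k M N ((i.1 : ℤ) - 1) * w ((i.1 : ℤ) - 1) := by
  have h1 : ∀ l : Fin N, JE (k : ℝ) M i.1 l.1 * w l.1 =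
      (if i.1 + 1 = l.1 then b (k : ℝ) (M + i.1 + 1) * w (i.1 + 1) else 0) +
      (if l.1 + 1 = i.1 then b (k : ℝ) (M + l.1 + 1) * w l.1 else 0) := by
    intro l
    unfold JE
    by_cases h : i.1 + 1 = l.1
    · have h' : ¬ (l.1 + 1 = i.1) := by omega
      simp only [h, h', if_true, if_false, add_zero]
      rw [← h]; push_cast; rfl
    · simp only [h, if_false, zero_add]
      split_ifs <;> simp
  rw [Finset.sum_congr rfl (fun l _ => h1 l), Finset.sum_add_distrib]
  congr 1
  · unfold aw
    by_cases h : i.1 + 1 < N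
    · rw [if_pos (by omega)]
      rw [Finset.sum_eq_single (⟨i.1 + 1, h⟩ : Fin N)]
      · simp
      · intro c _ hc
        rw [if_neg]
        intro h'; apply hc; ext; simp [h']
      · simp
    · rw [if_neg (by omega), zero_mul]
      apply Finset.sum_eq_zero
      intro l _
      rw [if_neg]
      have := l.2
      omega
  · unfold aw
    have hi := i.2
    by_cases h : 1 ≤ i.1
    · rw [if_pos (by omega)]
      rw [Finset.sum_eq_single (⟨i.1 - 1, by omega⟩ : Fin N)]
      · rw [if_pos (by simp; omega)]
        have e : ((i.1 : ℤ) - 1) = ((i.1 - 1 : ℕ) : ℤ) := by omega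
        rw [e]
        simp
      · intro c _ hc
        rw [if_neg]
        intro h'; apply hc; ext; simp; omega
      · simp
    · rw [if_neg (by omega), zero_mul]
      apply Finset.sum_eq_zero
      intro l _
      rw [if_neg]
      omega

/-- Jacobi matrix -/
def JM (k M N : ℕ) : Matrix (Fin N) (Fin N) ℝ := fun i j => JE (k : ℝ) M i.1 j.1

lemma JM_pow (k M N : ℕ) (j : ℕ) (i c : Fin N) :
    (JM k M N ^ j) i c = U (aw k M N) c.1 j i.1 := by
  induction j generalizing i with
  | zero =>
    simp [U, Matrix.one_apply, Fin.ext_iff]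
  | succ j ih =>
    rw [pow_succ', Matrix.mul_apply, Finset.sum_congr rfl (fun l _ => by rw [ih l]), U]
    exact JE_sum k M N (U (aw k M N) c.1 j) i

lemma JM_eig (k M N : ℕ) (x : ℝ) (hx : pA (k : ℝ) M N x = 0) (i : Fin N) :
    ∑ l : Fin N, JM k M N i l * pA (k : ℝ) M l.1 x = x * pA (k : ℝ) M i.1 x := by
  have := JE_sum k M N (fun s => pA (k : ℝ) M s.toNat x) i
  simp only [Int.toNat_natCast] at this
  unfold JM
  rw [this]
  have e1 : aw k M N i.1 * pA (k : ℝ) M ((i.1 : ℤ) + 1).toNat x =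
      b (k : ℝ) (M + i.1 + 1) * pA (k : ℝ) M (i.1 + 1) x := by
    have e : ((i.1 : ℤ) + 1).toNat = i.1 + 1 := by omega
    rw [e]
    unfold aw
    by_cases h : i.1 + 1 < N
    · rw [if_pos (by omega)]; simp
    · have : i.1 + 1 = N := by have := i.2; omega
      rw [this, hx]; simp
  rw [e1]
  obtain ⟨i, hi⟩ := i
  cases i with
  | zero =>
    have h0 := pA_rec0 k M x
    simp only [Nat.add_zero, zero_add]
    rw [h0, aw, if_neg (by simp)]
    simp
  | succ i =>
    have := pA_rec k M i x
    have e2 : (((i + 1 : ℕ) : ℤ) - 1) = (i : ℤ) := by push_cast; ring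
    simp only [e2, Int.toNat_natCast]
    rw [aw, if_pos (by omega)]
    simp only [Int.toNat_natCast]
    have e3 : M + (i + 1) + 1 = M + i + 2 := by ring
    rw [e3, show i + 1 + 1 = i + 2 from rfl, this]
    ring

lemma trace_pow (k M N : ℕ) (x : ℕ → ℝ) (hx : ∀ i < N, pA (k : ℝ) M N (x i) = 0)
    (hinj : ∀ i < N, ∀ i' < N, x i = x i' → i = i') (j : ℕ) :
    ∑ i ∈ Finset.range N, x i ^ j = ∑ i ∈ Finset.range N, U (aw k M N) i j i := by
  set V : Matrix (Fin N) (Fin N) ℝ := fun l i => pA (k : ℝ) M l.1 (x i.1) with hV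
  set D : Matrix (Fin N) (Fin N) ℝ := Matrix.diagonal (fun i : Fin N => x i.1) with hD
  have hAV : JM k M N * V = V * D := by
    ext i c
    rw [Matrix.mul_apply, hD, Matrix.mul_diagonal]
    rw [JM_eig k M N (x c.1) (hx _ c.2) i]
    simp only [hV]; ring
  have hpow : ∀ j, JM k M N ^ j * V = V * D ^ j := by
    intro j
    induction j with
    | zero => simp
    | succ j ih => rw [pow_succ', Matrix.mul_assoc, ih, ← Matrix.mul_assoc, hAV, Matrix.mul_assoc,
        ← pow_succ']
  have hli : LinearIndependent ℝ V.col := by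
    apply Module.End.eigenvectors_linearIndependent' (Matrix.toLin' (JM k M N))
      (fun i : Fin N => x i.1)
    · intro i i' h
      exact Fin.ext (hinj _ i.2 _ i'.2 h)
    · intro i
      rw [Module.End.hasEigenvector_iff, Module.End.mem_eigenspace_iff]
      constructor
      · ext l
        simp only [Matrix.toLin'_apply, Matrix.mulVec, dotProduct, Pi.smul_apply, smul_eq_mul]
        exact JM_eig k M N (x i.1) (hx _ i.2) l
      · intro h
        have h0 := congrFun h ⟨0, by have := i.2; omega⟩
        replace h0 : pA (k : ℝ) M 0 (x i.1) = 0 := h0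
        rw [pA] at h0
        have := b_pos k M
        have : 0 < 1 / b (k : ℝ) M := by positivity
        linarith
  have hu : IsUnit V := Matrix.linearIndependent_cols_iff_isUnit.1 hli
  have hdet : IsUnit V.det := (Matrix.isUnit_iff_isUnit_det _).1 hu
  have htr : (JM k M N ^ j).trace = (D ^ j).trace := by
    have : JM k M N ^ j = V * D ^ j * V⁻¹ := by
      rw [← hpow, Matrix.mul_assoc, Matrix.mul_nonsing_inv _ hdet, Matrix.mul_one]
    rw [this, Matrix.trace_mul_comm, ← Matrix.mul_assoc, Matrix.nonsing_inv_mul _ hdet,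
      Matrix.one_mul]
  rw [hD, Matrix.diagonal_pow, Matrix.trace_diagonal] at htr
  rw [Matrix.trace] at htr
  simp only [Matrix.diag_apply, JM_pow, Pi.pow_apply] at htr
  rw [Finset.sum_range, Finset.sum_range]
  exact htr.symm

/-! ### Local approximation of the coefficients -/

/-- limiting half-width -/
def bet (L k : ℕ) : ℝ := Real.sqrt ((1 - (k / L : ℝ) ^ 2) / 4)

lemma b_sq_L (k M s L : ℕ) (hL : L = k + M + s + 1) :
    b (k : ℝ) (M + s + 1) ^ 2 = ((L : ℝ) ^ 2 - k ^ 2) / (4 * (L : ℝ) ^ 2 - 1) := by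
  rw [b_succ_sq]
  subst hL
  push_cast
  congr 1 <;> ring

lemma b_le_one (k M s : ℕ) : b (k : ℝ) (M + s + 1) ≤ 1 := by
  have h := b_sq_L k M s _ rfl
  set L : ℕ := k + M + s + 1
  have hL : (1 : ℝ) ≤ (L : ℝ) := by exact_mod_cast (by omega : 1 ≤ L)
  have h2 : ((L : ℝ) ^ 2 - k ^ 2) / (4 * (L : ℝ) ^ 2 - 1) ≤ 1 := by
    rw [div_le_one (by nlinarith)]
    nlinarith
  have := b_pos k (M + s + 1)
  nlinarith

lemma aw_abs (k M N : ℕ) (s : ℤ) : |aw k M N s| ≤ 1 := by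
  unfold aw
  split_ifs
  · rw [abs_of_pos (b_pos _ _)]; exact b_le_one _ _ _
  · simp

lemma bet_nonneg (L k : ℕ) : 0 ≤ bet L k := Real.sqrt_nonneg _

lemma bet_sq (L k : ℕ) (h : k ≤ L) : bet L k ^ 2 = (1 - (k / L : ℝ) ^ 2) / 4 := by
  apply Real.sq_sqrt
  have h1 : (k / L : ℝ) ≤ 1 := div_le_one_of_le₀ (by exact_mod_cast h) (by positivity)
  have h0 : (0 : ℝ) ≤ (k / L : ℝ) := by positivity
  nlinarith

lemma bet_le_one (L k : ℕ) : bet L k ≤ 1 := by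
  unfold bet
  rw [Real.sqrt_le_one]
  have : 0 ≤ (k / L : ℝ) ^ 2 := by positivity
  linarith

lemma abs_sub_le_of_sq (u v δ : ℝ) (hu : 0 ≤ u) (hv : 0 ≤ v) (hδ : 0 ≤ δ)
    (h : |u ^ 2 - v ^ 2| ≤ δ ^ 2) : |u - v| ≤ δ := by
  apply abs_le_of_sq_le_sq _ hδ
  apply le_trans _ h
  have h1 : u ^ 2 - v ^ 2 = (u - v) * (u + v) := by ring
  rw [h1, abs_mul, ← sq_abs, sq]
  apply mul_le_mul_of_nonneg_left _ (abs_nonneg _)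
  rw [abs_of_nonneg (by positivity : 0 ≤ u + v), abs_le]
  constructor <;> linarith

lemma coef_close (r : ℕ) (δ : ℝ) (hδ : 0 < δ) : ∃ R : ℕ, ∀ k L L0 : ℕ, R ≤ L → R ≤ L0 → k ≤ L →
    k ≤ L0 → |(L : ℝ) - L0| ≤ r →
    |((L : ℝ) ^ 2 - k ^ 2) / (4 * (L : ℝ) ^ 2 - 1) - (1 - (k / L0 : ℝ) ^ 2) / 4| ≤ δ := by
  obtain ⟨R, hR⟩ := exists_nat_gt ((2 * r + 1) / δ)
  refine ⟨R + 1, ?_⟩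
  intro k L L0 h1 h2 h3 h4 h5
  have hR0 : (0 : ℝ) ≤ R := by positivity
  have a1 : (R : ℝ) + 1 ≤ L := by exact_mod_cast h1
  have a2 : (R : ℝ) + 1 ≤ L0 := by exact_mod_cast h2
  have a3 : (k : ℝ) ≤ L := by exact_mod_cast h3
  have a4 : (k : ℝ) ≤ L0 := by exact_mod_cast h4
  have a5 : (0 : ℝ) ≤ k := by positivity
  generalize (L : ℝ) = X at *
  generalize (L0 : ℝ) = Y at *
  generalize (k : ℝ) = z at *
  generalize (R : ℝ) = ρ at *
  have hX : 1 ≤ X := by linarith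
  have hY : 1 ≤ Y := by linarith
  have hδR : (2 * r + 1 : ℝ) ≤ δ * ρ := by
    rw [div_lt_iff₀ hδ] at hR; linarith
  have hr0 : (0 : ℝ) ≤ r := by positivity
  have b1 : |(X ^ 2 - z ^ 2) / (4 * X ^ 2 - 1) - (1 - (z / X) ^ 2) / 4| ≤ 1 / X := by
    have hp : 0 < 4 * X ^ 2 - 1 := by nlinarith
    have e : (X ^ 2 - z ^ 2) / (4 * X ^ 2 - 1) - (1 - (z / X) ^ 2) / 4 =
      (X ^ 2 - z ^ 2) / (4 * X ^ 2 * (4 * X ^ 2 - 1)) := by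
      obtain ⟨E, hE⟩ : ∃ E, E = 4 * X ^ 2 - 1 := ⟨_, rfl⟩
      rw [← hE] at hp ⊢
      field_simp
      rw [hE]
      ring
    have h0 : 0 ≤ X ^ 2 - z ^ 2 := by nlinarith
    rw [e, abs_of_nonneg (by positivity), div_le_div_iff₀ (by positivity) (by positivity)]
    have : X ≤ 4 * X ^ 2 - 1 := by nlinarith
    have h7 : X ^ 2 - z ^ 2 ≤ 4 * X ^ 2 := by nlinarith
    have := mul_le_mul h7 this (by positivity) (by positivity)
    linarith
  have b2 : |(1 - (z / X) ^ 2) / 4 - (1 - (z / Y) ^ 2) / 4| ≤ r * (1 / X + 1 / Y) := by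
    have e : (1 - (z / X) ^ 2) / 4 - (1 - (z / Y) ^ 2) / 4 =
      (X - Y) * ((z ^ 2 / (4 * (X * Y))) * (1 / X + 1 / Y)) := by
      field_simp
      ring
    rw [e, abs_mul]
    have h6 : z ^ 2 / (4 * (X * Y)) ≤ 1 := by
      rw [div_le_one (by positivity)]
      have : z * z ≤ X * Y := mul_le_mul a3 a4 a5 (by linarith)
      nlinarith
    have h7 : 0 ≤ z ^ 2 / (4 * (X * Y)) := by positivity
    have h8 : 0 ≤ 1 / X + 1 / Y := by positivity
    apply mul_le_mul h5 _ (abs_nonneg _) hr0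
    rw [abs_of_nonneg (by positivity)]
    nlinarith
  have c1 : 1 / X ≤ 1 / (ρ + 1) := one_div_le_one_div_of_le (by linarith) a1
  have c2 : 1 / Y ≤ 1 / (ρ + 1) := one_div_le_one_div_of_le (by linarith) a2
  have c3 : (2 * r + 1) * (1 / (ρ + 1)) ≤ δ := by
    rw [mul_one_div, div_le_iff₀ (by linarith)]
    nlinarith
  calc _ = |((X ^ 2 - z ^ 2) / (4 * X ^ 2 - 1) - (1 - (z / X) ^ 2) / 4) +
        ((1 - (z / X) ^ 2) / 4 - (1 - (z / Y) ^ 2) / 4)| := by congr 1; ring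
    _ ≤ _ := abs_add_le _ _
    _ ≤ 1 / X + r * (1 / X + 1 / Y) := add_le_add b1 b2
    _ ≤ 1 / (ρ + 1) + r * (1 / (ρ + 1) + 1 / (ρ + 1)) := by gcongr
    _ = (2 * r + 1) * (1 / (ρ + 1)) := by ring
    _ ≤ δ := c3

/-- the limiting diagonal entry -/
def FF (j L k : ℕ) : ℝ := bet L k ^ j * W j 0

lemma FF_bound (j L k : ℕ) : |FF j L k| ≤ 2 ^ j := by
  unfold FF
  rw [abs_mul, abs_of_nonneg (pow_nonneg (bet_nonneg L k) j)]
  calc bet L k ^ j * |W j 0| ≤ 1 * 2 ^ j := by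
        apply mul_le_mul _ (W_bound _ _) (abs_nonneg _) (by norm_num)
        exact pow_le_one₀ (bet_nonneg L k) (bet_le_one L k)
    _ = _ := by ring

lemma local_approx (j : ℕ) (ε : ℝ) (hε : 0 < ε) : ∃ R : ℕ, ∀ k M N i : ℕ, R ≤ i → i + R < N →
    |U (aw k M N) i j i - FF j (k + M + i) k| ≤ ε := by
  set δ : ℝ := ε / ((j + 1) * 2 ^ j) with hδ
  have hδ0 : 0 < δ := by positivity
  obtain ⟨R, hR⟩ := coef_close (j + 2) (δ ^ 2) (by positivity)
  refine ⟨R + j + 2, ?_⟩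
  intro k M N i h1 h2
  have := U_approx (aw k M N) (aw_abs k M N) i (bet (k + M + i) k) δ (bet_nonneg _ _)
    (bet_le_one _ _) hδ0.le j ?_ j le_rfl i
  · rw [sub_self] at this
    unfold FF
    apply this.trans
    rw [hδ, mul_div_assoc', div_le_iff₀ (by positivity)]
    have : 0 < (2 : ℝ) ^ j := by positivity
    nlinarith [mul_pos this hε]
  · intro s hs
    rw [abs_le] at hs
    unfold aw
    rw [if_pos (by omega)]
    apply abs_sub_le_of_sq _ _ _ (b_pos _ _).le (bet_nonneg _ _) hδ0.le
    rw [bet_sq _ _ (by omega), b_sq_L k M s.toNat _ rfl]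
    apply hR
    · omega
    · omega
    · omega
    · omega
    · have : |((k + M + s.toNat + 1 : ℕ) : ℤ) - ((k + M + i : ℕ) : ℤ)| ≤ ((j + 2 : ℕ) : ℤ) := by
        rw [abs_le]; omega
      exact_mod_cast this

lemma trace_approx (j : ℕ) (ε : ℝ) (hε : 0 < ε) : ∃ K : ℝ, 0 ≤ K ∧ ∀ k M N : ℕ,
    |∑ i ∈ Finset.range N, U (aw k M N) i j i - ∑ i ∈ Finset.range N, FF j (k + M + i) k| ≤
      ε * N + K := by
  obtain ⟨R, hR⟩ := local_approx j ε hε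
  refine ⟨2 * 2 ^ j * (2 * R), by positivity, ?_⟩
  intro k M N
  rw [← Finset.sum_sub_distrib]
  have hpt : ∀ i ∈ Finset.range N, |U (aw k M N) i j i - FF j (k + M + i) k| ≤
      ε + (2 * 2 ^ j * (if i < R then 1 else 0) + 2 * 2 ^ j * (if N ≤ i + R then 1 else 0)) := by
    intro i _
    have hb : |U (aw k M N) i j i - FF j (k + M + i) k| ≤ 2 * 2 ^ j := by
      have h1 := U_bound (aw k M N) (aw_abs k M N) i j i
      have h2 := FF_bound j (k + M + i) k
      have := abs_sub (U (aw k M N) i j i) (FF j (k + M + i) k)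
      linarith
    have hp : (0 : ℝ) < 2 * 2 ^ j := by positivity
    by_cases h1 : i < R
    · rw [if_pos h1]
      split_ifs <;> linarith
    · by_cases h2 : N ≤ i + R
      · rw [if_pos h2, if_neg h1]; linarith
      · rw [if_neg h1, if_neg h2]
        have := hR k M N i (by omega) (by omega)
        linarith
  refine (Finset.abs_sum_le_sum_abs _ _).trans ((Finset.sum_le_sum hpt).trans ?_)
  rw [Finset.sum_add_distrib, Finset.sum_add_distrib, ← Finset.mul_sum, ← Finset.mul_sum,
    Finset.sum_boole, Finset.sum_boole]
  simp only [Finset.sum_const, Finset.card_range, nsmul_eq_mul]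
  have c1 : ((Finset.range N).filter (fun i => i < R)).card ≤ R := by
    calc _ ≤ (Finset.range R).card := by
          apply Finset.card_le_card
          intro i hi; simp at *; exact hi.2
      _ = R := by simp
  have c2 : ((Finset.range N).filter (fun i => N ≤ i + R)).card ≤ R := by
    calc _ ≤ (Finset.Ico (N - R) N).card := by
          apply Finset.card_le_card
          intro i hi; simp at *; omega
      _ ≤ R := by simp; omega
  have c1' : (((Finset.range N).filter (fun i => i < R)).card : ℝ) ≤ R := by exact_mod_cast c1
  have c2' : (((Finset.range N).filter (fun i => N ≤ i + R)).card : ℝ) ≤ R := by exact_mod_cast c2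
  have hp : (0 : ℝ) < 2 * 2 ^ j := by positivity
  nlinarith

/-! ### Summing the limiting entries -/

/-- the beta-type integral -/
def II (r : ℕ) : ℝ := ∫ t in (0 : ℝ)..1, (1 - t ^ 2) ^ r

lemma II_succ (r : ℕ) : (2 * r + 3) * II (r + 1) = (2 * r + 2) * II r := by
  have hd : ∀ t ∈ Set.uIcc (0 : ℝ) 1, HasDerivAt (fun t : ℝ => t * (1 - t ^ 2) ^ (r + 1))
      ((2 * r + 3) * (1 - t ^ 2) ^ (r + 1) - (2 * r + 2) * (1 - t ^ 2) ^ r) t := by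
    intro t _
    have h1 : HasDerivAt (fun t : ℝ => 1 - t ^ 2) (-(2 * t)) t := by
      have := (hasDerivAt_pow 2 t).const_sub 1
      simpa using this
    have h2 := (hasDerivAt_id t).mul (h1.pow (r + 1))
    convert! h2 using 1
    simp only [id, Pi.pow_apply]
    push_cast
    ring
  have h := intervalIntegral.integral_eq_sub_of_hasDerivAt hd
    (Continuous.intervalIntegrable (by fun_prop) _ _)
  rw [intervalIntegral.integral_sub (Continuous.intervalIntegrable (by fun_prop) _ _)
    (Continuous.intervalIntegrable (by fun_prop) _ _), intervalIntegral.integral_const_mul,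
    intervalIntegral.integral_const_mul] at h
  simp at h
  unfold II
  linarith

lemma II_val (r : ℕ) : (Nat.centralBinom r : ℝ) * (1 / 4) ^ r * II r = 1 / (2 * r + 1) := by
  induction r with
  | zero => simp [II]
  | succ r ih =>
    have h1 := II_succ r
    have h2 : ((r : ℝ) + 1) * (Nat.centralBinom (r + 1) : ℝ) =
        2 * (2 * r + 1) * Nat.centralBinom r := by
      exact_mod_cast Nat.succ_mul_centralBinom_succ r
    have e1 : II (r + 1) = (2 * r + 2) * II r / (2 * r + 3) := by
      field_simp; linarith
    have e2 : (Nat.centralBinom (r + 1) : ℝ) = 2 * (2 * r + 1) * Nat.centralBinom r / (r + 1) := by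
      field_simp; linarith
    rw [e1, e2, pow_succ]
    push_cast
    have e3 : 2 * (2 * (r : ℝ) + 1) * (Nat.centralBinom r) / (r + 1) * ((1 / 4) ^ r * (1 / 4)) *
        ((2 * r + 2) * II r / (2 * r + 3)) = (2 * r + 1) *
        ((Nat.centralBinom r : ℝ) * (1 / 4) ^ r * II r) / (2 * r + 3) := by
      field_simp
      ring
    rw [e3, ih]
    field_simp
    ring

lemma G_bound (r L : ℕ) :
    |∑ k ∈ Finset.range (L + 1), (1 - (k / L : ℝ) ^ 2) ^ r - L * II r| ≤ 1 := by
  rcases Nat.eq_zero_or_pos L with rfl | hL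
  · simp
  have hL0 : (0 : ℝ) < L := by exact_mod_cast hL
  have hanti : AntitoneOn (fun t : ℝ => (1 - (t / L) ^ 2) ^ r) (Set.Icc 0 (0 + (L : ℝ))) := by
    intro s hs t ht hst
    simp only [zero_add, Set.mem_Icc] at hs ht
    have h1 : t / L ≤ 1 := by rw [div_le_one hL0]; exact ht.2
    have h2 : s / L ≤ t / L := by gcongr
    have h3 : 0 ≤ s / L := div_nonneg hs.1 hL0.le
    have h4 : 0 ≤ t / L := h3.trans h2
    apply pow_le_pow_left₀
    · nlinarith
    · nlinarith
  have h1 := hanti.sum_le_integral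
  have h2 := hanti.integral_le_sum
  have hint : ∫ t in (0 : ℝ)..0 + (L : ℝ), (1 - (t / L) ^ 2) ^ r = L * II r := by
    rw [intervalIntegral.integral_comp_div (fun t => (1 - t ^ 2) ^ r) hL0.ne']
    simp [II, hL0.ne']
  rw [hint] at h1 h2
  simp only [zero_add] at h1 h2
  have e1 := Finset.sum_range_succ (fun k : ℕ => (1 - (k / L : ℝ) ^ 2) ^ r) L
  have e2 := Finset.sum_range_succ' (fun k : ℕ => (1 - (k / L : ℝ) ^ 2) ^ r) L
  have h3 : 0 ≤ (1 - ((L : ℝ) / L) ^ 2) ^ r := by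
    rw [div_self hL0.ne']; simp
  simp only [Nat.cast_zero, zero_div, ne_eq, OfNat.ofNat_ne_zero, not_false_eq_true, zero_pow,
    sub_zero, one_pow] at e2
  rw [abs_le]
  constructor <;> linarith

lemma FF_even (r L k : ℕ) (h : k ≤ L) : FF (2 * r) L k =
    (Nat.centralBinom r : ℝ) * (1 / 4) ^ r * (1 - (k / L : ℝ) ^ 2) ^ r := by
  unfold FF
  rw [pow_mul, bet_sq L k h, W_even_zero, div_eq_mul_one_div (1 - (k / L : ℝ) ^ 2) 4, mul_pow]
  ring

lemma FF_odd (r L k : ℕ) : FF (2 * r + 1) L k = 0 := by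
  unfold FF
  rw [W_odd_zero, mul_zero]

lemma reorg (m n j : ℕ) (hmn : m ≤ n) :
    ∑ k ∈ Finset.range (n + 1), ∑ i ∈ Finset.range (Nk n m k), FF j (k + (m - k) + i) k =
      ∑ L ∈ Finset.Icc m n, ∑ k ∈ Finset.range (L + 1), FF j L k := by
  have h : ∀ k ∈ Finset.range (n + 1),
      ∑ i ∈ Finset.range (Nk n m k), FF j (k + (m - k) + i) k =
      ∑ L ∈ Finset.Ico (max k m) (n + 1), FF j L k := by
    intro k hk
    rw [Finset.mem_range] at hk
    rw [Finset.sum_Ico_eq_sum_range]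
    have e : k + (m - k) = max k m := by omega
    rw [e]
    congr 2
    unfold Nk; omega
  rw [Finset.sum_congr rfl h]
  apply Finset.sum_comm'
  intro k L
  simp only [Finset.mem_range, Finset.mem_Ico, Finset.mem_Icc]
  omega

lemma sum_Icc_approx (m : ℕ) (G : ℕ → ℝ) (I : ℝ) (hI : 0 ≤ I) (hG : ∀ L : ℕ, |G L - L * I| ≤ 1) :
    ∃ K : ℝ, ∀ n : ℕ, m ≤ n →
      |∑ L ∈ Finset.Icc m n, G L - I / 2 * ((n : ℝ) + 1) ^ 2| ≤ K * (n + 1) := by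
  have h1 : ∀ n : ℕ, |∑ L ∈ Finset.range (n + 1), G L - I / 2 * ((n : ℝ) + 1) ^ 2| ≤
      (1 + I) * (n + 1) := by
    intro n
    induction n with
    | zero =>
      have := hG 0
      simp at this ⊢
      rw [abs_le] at *
      constructor <;> linarith
    | succ n ih =>
      rw [Finset.sum_range_succ]
      have := hG (n + 1)
      push_cast at *
      rw [abs_le] at *
      constructor <;> nlinarith
  refine ⟨1 + I + |∑ L ∈ Finset.range m, G L|, ?_⟩
  intro n hn
  have e : ∑ L ∈ Finset.Icc m n, G L =
      ∑ L ∈ Finset.range (n + 1), G L - ∑ L ∈ Finset.range m, G L := by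
    rw [← Finset.sum_Ico_eq_sub _ (by omega)]
    rfl
  rw [e]
  have h2 := h1 n
  have h3 : (1 : ℝ) ≤ n + 1 := by linarith [(Nat.cast_nonneg n : (0 : ℝ) ≤ n)]
  have h4 := le_abs_self (∑ L ∈ Finset.range m, G L)
  have h5 := neg_abs_le (∑ L ∈ Finset.range m, G L)
  have h6 : |∑ L ∈ Finset.range m, G L| * 1 ≤ |∑ L ∈ Finset.range m, G L| * (n + 1) := by gcongr
  rw [abs_le] at h2 ⊢
  constructor <;> nlinarith

lemma II_nonneg (r : ℕ) : 0 ≤ II r := by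
  unfold II
  apply intervalIntegral.integral_nonneg (by norm_num)
  intro t ht
  apply pow_nonneg
  nlinarith [ht.1, ht.2]

lemma FF_sum (m j : ℕ) : ∃ K : ℝ, ∀ n : ℕ, m ≤ n →
    |∑ k ∈ Finset.range (n + 1), ∑ i ∈ Finset.range (Nk n m k), FF j (k + (m - k) + i) k -
      (1 / 4 * ∫ t in (-1 : ℝ)..1, t ^ j) * ((n : ℝ) + 1) ^ 2| ≤ K * (n + 1) := by
  rcases Nat.even_or_odd' j with ⟨r, rfl | rfl⟩
  · obtain ⟨K, hK⟩ := sum_Icc_approx m _ (II r) (II_nonneg r) (G_bound r)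
    set c : ℝ := (Nat.centralBinom r : ℝ) * (1 / 4) ^ r with hc
    have hc0 : 0 ≤ c := by positivity
    refine ⟨c * K, ?_⟩
    intro n hn
    rw [reorg m n _ hn]
    have e1 : ∑ L ∈ Finset.Icc m n, ∑ k ∈ Finset.range (L + 1), FF (2 * r) L k =
        c * ∑ L ∈ Finset.Icc m n, ∑ k ∈ Finset.range (L + 1), (1 - (k / L : ℝ) ^ 2) ^ r := by
      rw [Finset.mul_sum]
      apply Finset.sum_congr rfl
      intro L _
      rw [Finset.mul_sum]
      apply Finset.sum_congr rfl
      intro k hk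
      rw [Finset.mem_range] at hk
      rw [FF_even r L k (by omega)]
    have e2 : (1 / 4 * ∫ t in (-1 : ℝ)..1, t ^ (2 * r)) = c * (II r / 2) := by
      have := II_val r
      rw [← hc] at this
      have e3 : c * (II r / 2) = (c * II r) / 2 := by ring
      rw [e3, this, integral_pow]
      have : (-1 : ℝ) ^ (2 * r + 1) = -1 := by rw [pow_succ, pow_mul]; simp
      rw [this]
      push_cast
      field_simp
      norm_num
    rw [e1, e2]
    have e4 := hK n hn
    have e5 := mul_le_mul_of_nonneg_left e4 hc0
    rw [← abs_of_nonneg hc0, ← abs_mul, abs_of_nonneg hc0] at e5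
    calc _ = _ := by congr 1; ring
      _ ≤ _ := e5
      _ = _ := by ring
  · refine ⟨0, ?_⟩
    intro n hn
    have : (∫ t in (-1 : ℝ)..1, t ^ (2 * r + 1)) = 0 := by
      rw [integral_pow]
      have : (-1 : ℝ) ^ (2 * r + 1 + 1) = 1 := by
        rw [show 2 * r + 1 + 1 = 2 * (r + 1) by ring, pow_mul]; simp
      rw [this]; simp
    simp [FF_odd, this]

lemma moments (m : ℕ) (x : ℕ → ℕ → ℕ → ℝ)
    (hroot : ∀ n : ℕ, m ≤ n → ∀ k : ℕ, k ≤ n → ∀ i < Nk n m k,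
      pA (k : ℝ) (m - k) (Nk n m k) (x n k i) = 0)
    (hinj : ∀ n : ℕ, m ≤ n → ∀ k : ℕ, k ≤ n → ∀ i < Nk n m k, ∀ i' < Nk n m k,
      x n k i = x n k i' → i = i') (j : ℕ) :
    Filter.Tendsto (fun n : ℕ => (∑ k ∈ Finset.range (n + 1), ∑ i ∈ Finset.range (Nk n m k),
      x n k i ^ j) / ((n : ℝ) + 1) ^ 2) Filter.atTop
      (nhds (1 / 4 * ∫ t in (-1 : ℝ)..1, t ^ j)) := by
  rw [Metric.tendsto_atTop]
  intro ε hε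
  obtain ⟨K1, hK1⟩ := FF_sum m j
  obtain ⟨K2, hK20, hK2⟩ := trace_approx j (ε / 2) (by positivity)
  obtain ⟨n0, hn0⟩ := exists_nat_gt ((|K1| + K2) / (ε / 2))
  refine ⟨max m n0, ?_⟩
  intro n hn
  have hmn : m ≤ n := (le_max_left _ _).trans hn
  have hnn : (n0 : ℝ) ≤ n := by exact_mod_cast (le_max_right m n0).trans hn
  set I : ℝ := 1 / 4 * ∫ t in (-1 : ℝ)..1, t ^ j
  have h1 := hK1 n hmn
  have hn1 : (0 : ℝ) < n + 1 := by positivity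
  have h2 : |∑ k ∈ Finset.range (n + 1), ∑ i ∈ Finset.range (Nk n m k), x n k i ^ j -
      ∑ k ∈ Finset.range (n + 1), ∑ i ∈ Finset.range (Nk n m k), FF j (k + (m - k) + i) k| ≤
      (n + 1) * (ε / 2 * (n + 1) + K2) := by
    rw [← Finset.sum_sub_distrib]
    refine (Finset.abs_sum_le_sum_abs _ _).trans ?_
    calc _ ≤ ∑ k ∈ Finset.range (n + 1), (ε / 2 * ((n : ℝ) + 1) + K2) := by
          apply Finset.sum_le_sum
          intro k hk
          have hk' : k ≤ n := by rw [Finset.mem_range] at hk; omega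
          rw [trace_pow k (m - k) (Nk n m k) (x n k) (hroot n hmn k hk') (hinj n hmn k hk') j]
          refine (hK2 k (m - k) (Nk n m k)).trans ?_
          have : ((Nk n m k : ℕ) : ℝ) ≤ n + 1 := by
            exact_mod_cast (by unfold Nk; omega : Nk n m k ≤ n + 1)
          gcongr
      _ = _ := by simp; ring
  have h3 : |K1| + K2 < ε / 2 * (n + 1) := by
    rw [div_lt_iff₀ (by positivity)] at hn0
    nlinarith
  have h4 : K1 ≤ |K1| := le_abs_self _
  rw [Real.dist_eq]
  have e : (∑ k ∈ Finset.range (n + 1), ∑ i ∈ Finset.range (Nk n m k), x n k i ^ j) /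
      ((n : ℝ) + 1) ^ 2 - I = ((∑ k ∈ Finset.range (n + 1), ∑ i ∈ Finset.range (Nk n m k),
        x n k i ^ j) - I * ((n : ℝ) + 1) ^ 2) / ((n : ℝ) + 1) ^ 2 := by
    field_simp
  rw [e, abs_div, abs_of_pos (by positivity : 0 < ((n : ℝ) + 1) ^ 2), div_lt_iff₀ (by positivity)]
  generalize (∑ k ∈ Finset.range (n + 1), ∑ i ∈ Finset.range (Nk n m k), x n k i ^ j) = A at *
  generalize (∑ k ∈ Finset.range (n + 1), ∑ i ∈ Finset.range (Nk n m k),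
    FF j (k + (m - k) + i) k) = B at *
  calc |A - I * ((n : ℝ) + 1) ^ 2| = |(A - B) + (B - I * ((n : ℝ) + 1) ^ 2)| := by congr 1; ring
    _ ≤ _ := abs_add_le _ _
    _ ≤ (n + 1) * (ε / 2 * (n + 1) + K2) + K1 * (n + 1) := add_le_add h2 h1
    _ < _ := by nlinarith [mul_lt_mul_of_pos_right h3 hn1, mul_le_mul_of_nonneg_right h4 hn1.le]

/-! ### From moments to Riemann integrable functions -/

lemma exists_cont_below (f : ℝ → ℝ) (C : ℝ)
    (hbdd : ∀ t ∈ Set.Icc (-1 : ℝ) 1, |f t| ≤ C)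
    (hcont : ∀ᵐ t ∂(volume.restrict (Set.Icc (-1 : ℝ) 1)), ContinuousAt f t)
    (ε : ℝ) (hε : 0 < ε) :
    ∃ g : ℝ → ℝ, Continuous g ∧ (∀ t ∈ Set.Icc (-1 : ℝ) 1, g t ≤ f t) ∧
      (∫ t in (-1 : ℝ)..1, f t) ≤ (∫ t in (-1 : ℝ)..1, g t) + ε := by
  have hC : 0 ≤ C := (abs_nonneg _).trans (hbdd 0 (by norm_num))
  have : Nonempty (Set.Icc (-1 : ℝ) 1) := ⟨⟨0, by norm_num⟩⟩
  set g : ℕ → ℝ → ℝ := fun K t => ⨅ s : Set.Icc (-1 : ℝ) 1, (f s + K * |t - s|) with hg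
  have hlow : ∀ (K : ℕ) (t : ℝ) (s : Set.Icc (-1 : ℝ) 1), -C ≤ f s + K * |t - s| := by
    intro K t s
    have := (abs_le.1 (hbdd s s.2)).1
    have : 0 ≤ (K : ℝ) * |t - s| := by positivity
    linarith
  have hbb : ∀ (K : ℕ) (t : ℝ), BddBelow (Set.range
      (fun s : Set.Icc (-1 : ℝ) 1 => f s + K * |t - s|)) := by
    intro K t
    refine ⟨-C, ?_⟩
    rintro _ ⟨s, rfl⟩
    exact hlow K t s
  have hle : ∀ (K : ℕ) (t : ℝ), t ∈ Set.Icc (-1 : ℝ) 1 → g K t ≤ f t := by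
    intro K t ht
    have := ciInf_le (hbb K t) ⟨t, ht⟩
    simpa using this
  have hge : ∀ (K : ℕ) (t : ℝ), -C ≤ g K t := fun K t => le_ciInf (hlow K t)
  have hcontg : ∀ K : ℕ, Continuous (g K) := by
    intro K
    have hl : LipschitzWith (K : NNReal) (g K) := by
      apply LipschitzWith.of_le_add_mul
      intro t t'
      rw [← sub_le_iff_le_add]
      apply le_ciInf
      intro s
      have h1 := ciInf_le (hbb K t) s
      have h2 : |t - s| ≤ dist t t' + |t' - s| := by
        rw [Real.dist_eq]; exact abs_sub_le _ _ _
      have h3 : (K : ℝ) * |t - s| ≤ K * (dist t t' + |t' - s|) := by gcongr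
      have h4 : ((K : NNReal) : ℝ) = K := by simp
      rw [h4]
      simp only [hg]
      linarith
    exact hl.continuous
  have hconv : ∀ t ∈ Set.Icc (-1 : ℝ) 1, ContinuousAt f t →
      Filter.Tendsto (fun K : ℕ => g K t) Filter.atTop (nhds (f t)) := by
    intro t ht hct
    rw [Metric.tendsto_atTop]
    intro e he
    obtain ⟨δ, hδ, hδ'⟩ := Metric.continuousAt_iff.1 hct (e / 2) (by positivity)
    obtain ⟨K0, hK0⟩ := exists_nat_gt (2 * C / δ)
    refine ⟨K0, ?_⟩
    intro K hK
    have hKK : (K0 : ℝ) ≤ K := by exact_mod_cast hK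
    have h1 := hle K t ht
    have h2 : f t - e / 2 ≤ g K t := by
      apply le_ciInf
      intro s
      by_cases hs : |t - s| < δ
      · have := hδ' (x := (s : ℝ)) (by rw [Real.dist_eq, abs_sub_comm]; exact hs)
        rw [Real.dist_eq, abs_lt] at this
        have : 0 ≤ (K : ℝ) * |t - s| := by positivity
        linarith
      · push Not at hs
        have a1 : 2 * C < K * δ := by
          rw [div_lt_iff₀ hδ] at hK0
          nlinarith
        have a2 : (K : ℝ) * δ ≤ K * |t - s| := by gcongr
        have a3 := (abs_le.1 (hbdd s s.2)).1
        have a4 := (abs_le.1 (hbdd t ht)).2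
        linarith
    rw [Real.dist_eq, abs_lt]
    constructor <;> linarith
  have hlim : Filter.Tendsto (fun K : ℕ => ∫ t in (-1 : ℝ)..1, g K t) Filter.atTop
      (nhds (∫ t in (-1 : ℝ)..1, f t)) := by
    have hmem : ∀ t ∈ Set.uIoc (-1 : ℝ) 1, t ∈ Set.Icc (-1 : ℝ) 1 := by
      intro t ht
      rw [Set.uIoc_of_le (by norm_num)] at ht
      exact ⟨ht.1.le, ht.2⟩
    apply intervalIntegral.tendsto_integral_filter_of_dominated_convergence (fun _ => C)
    · exact Filter.Eventually.of_forall fun K => (hcontg K).aestronglyMeasurable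
    · refine Filter.Eventually.of_forall fun K => Filter.Eventually.of_forall fun t ht => ?_
      rw [Real.norm_eq_abs, abs_le]
      exact ⟨hge K t, (hle K t (hmem t ht)).trans (abs_le.1 (hbdd t (hmem t ht))).2⟩
    · exact intervalIntegrable_const
    · rw [ae_restrict_iff' measurableSet_Icc] at hcont
      filter_upwards [hcont] with t ht htm
      exact hconv t (hmem t htm) (ht (hmem t htm))
  have hev := (Metric.tendsto_atTop.1 hlim) ε hε
  obtain ⟨K, hK⟩ := hev
  refine ⟨g K, hcontg K, hle K, ?_⟩
  have := hK K le_rfl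
  rw [Real.dist_eq, abs_lt] at this
  linarith

section ext

variable {ι : Type} (s : ℕ → Finset ι) (y : ℕ → ι → ℝ) (d : ℕ → ℝ)

lemma ext_poly (hmom : ∀ j : ℕ, Filter.Tendsto (fun n => (∑ q ∈ s n, y n q ^ j) / d n) Filter.atTop
      (nhds (1 / 4 * ∫ t in (-1 : ℝ)..1, t ^ j))) (P : Polynomial ℝ) :
    Filter.Tendsto (fun n => (∑ q ∈ s n, P.eval (y n q)) / d n) Filter.atTop
      (nhds (1 / 4 * ∫ t in (-1 : ℝ)..1, P.eval t)) := by
  have e1 : ∀ n, (∑ q ∈ s n, P.eval (y n q)) / d n =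
      ∑ j ∈ Finset.range (P.natDegree + 1), P.coeff j * ((∑ q ∈ s n, y n q ^ j) / d n) := by
    intro n
    simp_rw [Polynomial.eval_eq_sum_range]
    rw [Finset.sum_comm, Finset.sum_div]
    apply Finset.sum_congr rfl
    intro j _
    rw [← Finset.mul_sum, mul_div_assoc]
  have e2 : 1 / 4 * ∫ t in (-1 : ℝ)..1, P.eval t =
      ∑ j ∈ Finset.range (P.natDegree + 1), P.coeff j * (1 / 4 * ∫ t in (-1 : ℝ)..1, t ^ j) := by
    simp_rw [Polynomial.eval_eq_sum_range]
    rw [intervalIntegral.integral_finsetSum, Finset.mul_sum]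
    · apply Finset.sum_congr rfl
      intro j _
      rw [intervalIntegral.integral_const_mul]
      ring
    · intro j _
      exact Continuous.intervalIntegrable (by fun_prop) _ _
  simp_rw [e1]
  rw [e2]
  exact tendsto_finsetSum _ fun j _ => (hmom j).const_mul _

lemma ext_cont (hd : ∀ n, 0 < d n) (m : ℕ)
    (hy : ∀ n, m ≤ n → ∀ q ∈ s n, y n q ∈ Set.Icc (-1 : ℝ) 1)
    (hmom : ∀ j : ℕ, Filter.Tendsto (fun n => (∑ q ∈ s n, y n q ^ j) / d n) Filter.atTop
      (nhds (1 / 4 * ∫ t in (-1 : ℝ)..1, t ^ j))) (g : ℝ → ℝ) (hg : Continuous g) :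
    Filter.Tendsto (fun n => (∑ q ∈ s n, g (y n q)) / d n) Filter.atTop
      (nhds (1 / 4 * ∫ t in (-1 : ℝ)..1, g t)) := by
  rw [Metric.tendsto_atTop]
  intro ε hε
  obtain ⟨P, hP⟩ := exists_polynomial_near_of_continuousOn (-1) 1 g hg.continuousOn (ε / 4)
    (by positivity)
  obtain ⟨n1, hn1⟩ := Metric.tendsto_atTop.1 (ext_poly s y d hmom P) (ε / 4) (by positivity)
  obtain ⟨n2, hn2⟩ := Metric.tendsto_atTop.1 (hmom 0) (1 / 2) (by norm_num)
  refine ⟨max m (max n1 n2), ?_⟩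
  intro n hn
  have hm : m ≤ n := by omega
  have h1 := hn1 n (by omega)
  have h2 := hn2 n (by omega)
  have hcard : ((s n).card : ℝ) / d n ≤ 1 := by
    rw [Real.dist_eq, abs_lt] at h2
    simp at h2
    norm_num at h2
    linarith [h2.2]
  have h3 : |(∑ q ∈ s n, g (y n q)) / d n - (∑ q ∈ s n, P.eval (y n q)) / d n| ≤ ε / 4 := by
    rw [← sub_div, ← Finset.sum_sub_distrib, abs_div, abs_of_pos (hd n)]
    calc _ ≤ (∑ q ∈ s n, ε / 4) / d n := by
          apply div_le_div_of_nonneg_right _ (hd n).le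
          refine (Finset.abs_sum_le_sum_abs _ _).trans (Finset.sum_le_sum fun q hq => ?_)
          rw [abs_sub_comm]
          exact (hP _ (hy n hm q hq)).le
      _ = ((s n).card : ℝ) / d n * (ε / 4) := by
        rw [Finset.sum_const, nsmul_eq_mul]; ring
      _ ≤ 1 * (ε / 4) := by gcongr
      _ = _ := by ring
  have h4 : |(∫ t in (-1 : ℝ)..1, P.eval t) - ∫ t in (-1 : ℝ)..1, g t| ≤ ε / 4 * 2 := by
    rw [← intervalIntegral.integral_sub (Continuous.intervalIntegrable (by fun_prop) _ _)
      (hg.intervalIntegrable _ _)]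
    have := intervalIntegral.norm_integral_le_of_norm_le_const (a := (-1 : ℝ)) (b := 1)
      (f := fun t => P.eval t - g t) (C := ε / 4) (by
        intro t ht
        rw [Set.uIoc_of_le (by norm_num)] at ht
        exact (hP t ⟨ht.1.le, ht.2⟩).le)
    rw [Real.norm_eq_abs] at this
    norm_num at this ⊢
    linarith
  rw [Real.dist_eq, abs_lt] at h1 ⊢
  rw [abs_le] at h3 h4
  constructor <;> linarith

lemma ext_riem (hd : ∀ n, 0 < d n) (m : ℕ)
    (hy : ∀ n, m ≤ n → ∀ q ∈ s n, y n q ∈ Set.Icc (-1 : ℝ) 1)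
    (hmom : ∀ j : ℕ, Filter.Tendsto (fun n => (∑ q ∈ s n, y n q ^ j) / d n) Filter.atTop
      (nhds (1 / 4 * ∫ t in (-1 : ℝ)..1, t ^ j))) (f : ℝ → ℝ) (C : ℝ)
    (hbdd : ∀ t ∈ Set.Icc (-1 : ℝ) 1, |f t| ≤ C)
    (hcont : ∀ᵐ t ∂(volume.restrict (Set.Icc (-1 : ℝ) 1)), ContinuousAt f t) :
    Filter.Tendsto (fun n => (∑ q ∈ s n, f (y n q)) / d n) Filter.atTop
      (nhds (1 / 4 * ∫ t in (-1 : ℝ)..1, f t)) := by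
  rw [Metric.tendsto_atTop]
  intro ε hε
  obtain ⟨g, hg, hgf, hgi⟩ := exists_cont_below f C hbdd hcont ε hε
  obtain ⟨h, hh, hhf, hhi⟩ := exists_cont_below (fun t => - f t) C
    (fun t ht => by rw [abs_neg]; exact hbdd t ht)
    (hcont.mono fun t ht => ht.neg) ε hε
  rw [intervalIntegral.integral_neg] at hhi
  obtain ⟨n1, hn1⟩ := Metric.tendsto_atTop.1 (ext_cont s y d hd m hy hmom g hg) (ε / 2)
    (by positivity)
  obtain ⟨n2, hn2⟩ := Metric.tendsto_atTop.1 (ext_cont s y d hd m hy hmom h hh) (ε / 2)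
    (by positivity)
  refine ⟨max m (max n1 n2), ?_⟩
  intro n hn
  have h1 := hn1 n (by omega)
  have h2 := hn2 n (by omega)
  have h3 : (∑ q ∈ s n, g (y n q)) / d n ≤ (∑ q ∈ s n, f (y n q)) / d n := by
    apply div_le_div_of_nonneg_right _ (hd n).le
    exact Finset.sum_le_sum fun q hq => hgf _ (hy n (by omega) q hq)
  have h4 : (∑ q ∈ s n, h (y n q)) / d n ≤ -((∑ q ∈ s n, f (y n q)) / d n) := by
    rw [← neg_div, ← Finset.sum_neg_distrib]
    apply div_le_div_of_nonneg_right _ (hd n).le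
    exact Finset.sum_le_sum fun q hq => hhf _ (hy n (by omega) q hq)
  rw [Real.dist_eq, abs_lt] at *
  constructor <;> linarith

end ext

lemma sum_int (n : ℕ) (g : ℕ → ℝ) : ∑ k ∈ Finset.Icc (-(n : ℤ)) (n : ℤ), g k.natAbs =
    2 * ∑ k ∈ Finset.range (n + 1), g k - g 0 := by
  induction n with
  | zero => simp; ring
  | succ n ih =>
    have e : Finset.Icc (-((n + 1 : ℕ) : ℤ)) ((n + 1 : ℕ) : ℤ) =
        insert (-((n + 1 : ℕ) : ℤ)) (insert ((n + 1 : ℕ) : ℤ) (Finset.Icc (-(n : ℤ)) (n : ℤ))) := by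
      ext k
      simp only [Finset.mem_Icc, Finset.mem_insert]
      omega
    rw [e, Finset.sum_insert, Finset.sum_insert, ih, Finset.sum_range_succ _ (n + 1)]
    · rw [Int.natAbs_neg, Int.natAbs_natCast]; ring
    · simp
    · simp; omega

/-- weak limit of the eigenvalue distribution. `f` is bounded and Riemann
integrable on `[−1,1]` (encoded by Lebesgue's criterion: bounded and a.e. continuous), and
for each `n ≥ m` the numbers `x n k i`, `i < N_k`, enumerate the roots of the relevant
(associated) ultraspherical polynomials. Then
`(1/N_n^m) Σ_{k=−n}^n Σ_{i=1}^{N_k} f(x_{|k|,i}) → (1/2)∫_{−1}^1 f`. -/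
theorem stmt17 (m : ℕ) (f : ℝ → ℝ) (C : ℝ)
    (hbdd : ∀ t ∈ Set.Icc (-1 : ℝ) 1, |f t| ≤ C)
    (hcont : ∀ᵐ t ∂(volume.restrict (Set.Icc (-1 : ℝ) 1)), ContinuousAt f t)
    (x : ℕ → ℕ → ℕ → ℝ)
    (hroot : ∀ n : ℕ, m ≤ n → ∀ k : ℕ, k ≤ n → ∀ i < Nk n m k,
      pA (k : ℝ) (m - k) (Nk n m k) (x n k i) = 0)
    (hinj : ∀ n : ℕ, m ≤ n → ∀ k : ℕ, k ≤ n → ∀ i < Nk n m k, ∀ i' < Nk n m k,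
      x n k i = x n k i' → i = i') :
    Filter.Tendsto
      (fun n : ℕ => (1 / ((((n + 1) ^ 2 - m ^ 2 : ℕ) : ℝ))) *
        ∑ k ∈ Finset.Icc (-(n : ℤ)) (n : ℤ), ∑ i ∈ Finset.range (Nk n m k.natAbs),
          f (x n k.natAbs i))
      Filter.atTop (nhds ((1 / 2) * ∫ t in (-1 : ℝ)..1, f t)) := by
  have hmem : ∀ n : ℕ, m ≤ n → ∀ k : ℕ, k ≤ n → ∀ i < Nk n m k,
      x n k i ∈ Set.Icc (-1 : ℝ) 1 := fun n hn k hk i hi =>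
    root_mem k (m - k) (Nk n m k) _ (hroot n hn k hk i hi)
  have hC : 0 ≤ C := (abs_nonneg _).trans (hbdd 0 (by norm_num))
  have hmain : Filter.Tendsto (fun n : ℕ => (∑ k ∈ Finset.range (n + 1),
      ∑ i ∈ Finset.range (Nk n m k), f (x n k i)) / ((n : ℝ) + 1) ^ 2) Filter.atTop
      (nhds (1 / 4 * ∫ t in (-1 : ℝ)..1, f t)) := by
    have := ext_riem (ι := Σ _ : ℕ, ℕ)
      (fun n => (Finset.range (n + 1)).sigma (fun k => Finset.range (Nk n m k)))
      (fun n q => x n q.1 q.2) (fun n => ((n : ℝ) + 1) ^ 2) (fun n => by positivity) m ?_ ?_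
      f C hbdd hcont
    · simpa only [Finset.sum_sigma] using this
    · intro n hn q hq
      simp only [Finset.mem_sigma, Finset.mem_range] at hq
      exact hmem n hn q.1 (by omega) q.2 hq.2
    · intro j
      simpa only [Finset.sum_sigma] using moments m x hroot hinj j
  have hinv : Filter.Tendsto (fun n : ℕ => 1 / ((n : ℝ) + 1)) Filter.atTop (nhds 0) :=
    tendsto_one_div_add_atTop_nhds_zero_nat
  have hzero : Filter.Tendsto (fun n : ℕ => (∑ i ∈ Finset.range (Nk n m 0), f (x n 0 i)) /
      ((n : ℝ) + 1) ^ 2) Filter.atTop (nhds 0) := by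
    have hC' := hinv.const_mul C
    rw [mul_zero] at hC'
    apply squeeze_zero_norm' _ hC'
    filter_upwards [Filter.eventually_ge_atTop m] with n hn
    rw [Real.norm_eq_abs, abs_div, abs_of_pos (by positivity : 0 < ((n : ℝ) + 1) ^ 2),
      div_le_iff₀ (by positivity)]
    calc _ ≤ ∑ i ∈ Finset.range (Nk n m 0), C := by
          refine (Finset.abs_sum_le_sum_abs _ _).trans (Finset.sum_le_sum fun i hi => ?_)
          exact hbdd _ (hmem n hn 0 (by omega) i (Finset.mem_range.1 hi))
      _ = (Nk n m 0 : ℝ) * C := by simp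
      _ ≤ ((n : ℝ) + 1) * C := by
        have : ((Nk n m 0 : ℕ) : ℝ) ≤ n + 1 := by
          exact_mod_cast (by unfold Nk; omega : Nk n m 0 ≤ n + 1)
        gcongr
      _ = _ := by field_simp
  have hratio : Filter.Tendsto (fun n : ℕ => (1 - (m : ℝ) ^ 2 * (1 / ((n : ℝ) + 1)) ^ 2)⁻¹)
      Filter.atTop (nhds 1) := by
    have h1 := (hinv.pow 2).const_mul ((m : ℝ) ^ 2)
    have h2 := (h1.const_sub 1).inv₀ (by simp)
    simpa using h2
  have hfin := hratio.mul ((hmain.const_mul 2).sub hzero)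
  have e : (1 : ℝ) * (2 * (1 / 4 * ∫ t in (-1 : ℝ)..1, f t) - 0) =
      1 / 2 * ∫ t in (-1 : ℝ)..1, f t := by ring
  rw [e] at hfin
  refine hfin.congr' ?_
  filter_upwards [Filter.eventually_ge_atTop m] with n hn
  rw [sum_int n (fun k => ∑ i ∈ Finset.range (Nk n m k), f (x n k i))]
  have hle : m ^ 2 ≤ (n + 1) ^ 2 := Nat.pow_le_pow_left (by omega) 2
  rw [Nat.cast_sub hle]
  push_cast
  have hlt : (m : ℝ) ^ 2 < ((n : ℝ) + 1) ^ 2 := by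
    exact_mod_cast Nat.pow_lt_pow_left (by omega : m < n + 1) (by norm_num)
  have hn1 : (0 : ℝ) < ((n : ℝ) + 1) ^ 2 := by positivity
  have e2 : 1 - (m : ℝ) ^ 2 * (1 / ((n : ℝ) + 1)) ^ 2 =
      (((n : ℝ) + 1) ^ 2 - (m : ℝ) ^ 2) / ((n : ℝ) + 1) ^ 2 := by
    field_simp
  rw [e2, inv_div]
  have hne : (((n : ℝ) + 1) ^ 2 - (m : ℝ) ^ 2) ≠ 0 := by linarith
  generalize (((n : ℝ) + 1) ^ 2 - (m : ℝ) ^ 2) = Z at *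
  field_simp
end SFT
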